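/- arXiv:1302.3308 — 2 statements merged into one kernel-verified Lean document; each statement's English description precedes it below -/
import Mathlib

section
/- Let f, g ∈ F[Y ∪ Z]. If g has at most r monomials (i.e., the support of g has size at most r), then maxrank(M_{fg}) ≤ r · maxrank(M_f). -/
open scoped Classical

noncomputable section

namespace PCM

variable {F : Type} [Field F] {Y Z : Type} [Fintype Y] [Fintype Z]

/-- Exponent vector of the monic multilinear monomial `∏_{y ∈ p} y · ∏_{z ∈ q} z`. -/
def mexp (p : Finset Y) (q : Finset Z) : (Y ⊕ Z) →₀ ℕ :=
  (∑ y ∈ p, Finsupp.single (Sum.inl y) 1) + ∑ z ∈ q, Finsupp.single (Sum.inr z) 1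

/-- The polynomial coefficient matrix `M_f`. -/
def coeffMatrix (f : MvPolynomial (Y ⊕ Z) F) :
    Matrix (Finset Y) (Finset Z) (MvPolynomial (Y ⊕ Z) F) := fun p q =>
  ∑ d ∈ f.support,
    if d.support ⊆ p.image Sum.inl ∪ q.image Sum.inr ∧ mexp p q ≤ d then
      MvPolynomial.monomial (d - mexp p q) (MvPolynomial.coeff d f)
    else 0

/-- `maxrank(M_f)`: the maximum, over substitutions `S`, of the rank of `M_f|_S`. -/
def maxrank (f : MvPolynomial (Y ⊕ Z) F) : ℕ :=
  ⨆ S : (Y ⊕ Z) → F, ((coeffMatrix f).map (MvPolynomial.eval S)).rank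

/-- The partial derivatives matrix `L_f`. -/
def pdMatrix (f : MvPolynomial (Y ⊕ Z) F) : Matrix (Finset Y) (Finset Z) F := fun p q =>
  MvPolynomial.coeff (mexp p q) f

end PCM

namespace PCM

section Weights

variable {K X : Type} [Field K] [Fintype X]

/-- The column of weights at `s` of the exponent vector `u`, concentrated at the support of `u`. -/
def supportWeight (s : X → K) (u : X → ℕ) (p : Finset X) : K :=
  if p = Finset.univ.filter (fun x => u x ≠ 0) then ∏ x ∈ p, s x ^ (u x - 1) else 0

/-- The matrix carrying the weights of `u` to the weights of `u + v`. -/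
def shiftMatrix (s : X → K) (v : X → ℕ) : Matrix (Finset X) (Finset X) K := fun p p' =>
  if p = p' ∪ Finset.univ.filter (fun x => v x ≠ 0) then
    ∏ x ∈ p, s x ^ (v x + (if x ∈ p' then 1 else 0) - 1)
  else 0

open Matrix in
theorem shiftMatrix_mulVec_supportWeight (s : X → K) (u v : X → ℕ) :
    shiftMatrix s v *ᵥ supportWeight s u = supportWeight s (u + v) := by
  ext p
  have hsupp : Finset.univ.filter (fun x => (u + v) x ≠ 0) =
      Finset.univ.filter (fun x => u x ≠ 0) ∪ Finset.univ.filter (fun x => v x ≠ 0) := by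
    ext x
    simp only [Pi.add_apply, Finset.mem_union, Finset.mem_filter, Finset.mem_univ, true_and]
    omega
  rw [Matrix.mulVec, dotProduct,
    Finset.sum_eq_single (Finset.univ.filter (fun x => u x ≠ 0))
      (fun p' _ hp' => by simp only [supportWeight, if_neg hp', mul_zero]) (by simp)]
  simp only [shiftMatrix, supportWeight, if_true, hsupp]
  split_ifs with hp
  · have hsub : Finset.univ.filter (fun x => u x ≠ 0) ⊆ p := hp ▸ Finset.subset_union_left
    rw [Finset.prod_subset hsub (f := fun x => s x ^ (u x - 1)) (fun x _ hx => by
      have : u x = 0 := by simpa using hx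
      simp [this]), ← Finset.prod_mul_distrib]
    refine Finset.prod_congr rfl fun x _ => ?_
    rw [← pow_add]
    congr 1
    simp only [Finset.mem_filter, Finset.mem_univ, true_and, Pi.add_apply]
    split_ifs <;> omega
  · simp

theorem rank_add_le {m n : Type} [Fintype m] [Fintype n] (A B : Matrix m n K) :
    (A + B).rank ≤ A.rank + B.rank := by
  rw [Matrix.rank, Matrix.mulVecLin_add]
  exact (Submodule.finrank_mono (LinearMap.range_add_le _ _)).trans
    (Submodule.finrank_add_le_finrank_add_finrank _ _)

end Weights

variable {F : Type} [Field F] {Y Z : Type}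

theorem mexp_inl (p : Finset Y) (q : Finset Z) (y : Y) :
    mexp p q (Sum.inl y) = if y ∈ p then 1 else 0 := by
  simp [mexp, Finsupp.single_apply]

theorem mexp_inr (p : Finset Y) (q : Finset Z) (z : Z) :
    mexp p q (Sum.inr z) = if z ∈ q then 1 else 0 := by
  simp [mexp, Finsupp.single_apply]

variable [Fintype Y] [Fintype Z]

theorem support_subset_and_mexp_le_iff (p : Finset Y) (q : Finset Z) (d : (Y ⊕ Z) →₀ ℕ) :
    (d.support ⊆ p.image Sum.inl ∪ q.image Sum.inr ∧ mexp p q ≤ d) ↔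
      p = Finset.univ.filter (fun y => d (Sum.inl y) ≠ 0) ∧
        q = Finset.univ.filter (fun z => d (Sum.inr z) ≠ 0) := by
  simp only [Finset.subset_iff, Finsupp.le_def, Sum.forall, mexp_inl, mexp_inr, Finset.ext_iff,
    Finset.mem_union, Finset.mem_image, Finsupp.mem_support_iff, Finset.mem_filter,
    Finset.mem_univ, true_and, Sum.inl.injEq, Sum.inr.injEq, exists_eq_right, reduceCtorEq,
    and_false, exists_false, or_false, false_or]
  constructor
  · rintro ⟨⟨h1, h2⟩, h3, h4⟩
    refine ⟨fun y => ⟨fun hy => ?_, h1 y⟩, fun z => ⟨fun hz => ?_, h2 z⟩⟩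
    · have := h3 y
      rw [if_pos hy] at this
      omega
    · have := h4 z
      rw [if_pos hz] at this
      omega
  · rintro ⟨h1, h2⟩
    refine ⟨⟨fun y => (h1 y).2, fun z => (h2 z).2⟩, fun y => ?_, fun z => ?_⟩
    · have := h1 y
      split_ifs with hy
      · have := this.1 hy
        omega
      · omega
    · have := h2 z
      split_ifs with hz
      · have := this.1 hz
        omega
      · omega

/-- The matrix `M_f|_S`. -/
def evalMatrix (S : (Y ⊕ Z) → F) (f : MvPolynomial (Y ⊕ Z) F) :
    Matrix (Finset Y) (Finset Z) F :=
  (coeffMatrix f).map (MvPolynomial.eval S)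

theorem evalMatrix_eq_sum (S : (Y ⊕ Z) → F) (f : MvPolynomial (Y ⊕ Z) F) :
    evalMatrix S f = ∑ d ∈ f.support, f.coeff d • Matrix.vecMulVec
      (supportWeight (S ∘ Sum.inl) (d ∘ Sum.inl)) (supportWeight (S ∘ Sum.inr) (d ∘ Sum.inr)) := by
  ext p q
  simp only [evalMatrix, Matrix.map_apply, coeffMatrix, map_sum, Matrix.sum_apply,
    Matrix.smul_apply, Matrix.vecMulVec_apply, smul_eq_mul]
  refine Finset.sum_congr rfl fun d _ => ?_
  simp only [support_subset_and_mexp_le_iff, supportWeight, Function.comp_apply]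
  by_cases hp : p = Finset.univ.filter (fun y => d (Sum.inl y) ≠ 0)
  · by_cases hq : q = Finset.univ.filter (fun z => d (Sum.inr z) ≠ 0)
    · rw [if_pos ⟨hp, hq⟩, if_pos hp, if_pos hq, MvPolynomial.eval_monomial,
        Finsupp.prod_fintype _ _ (by simp), Fintype.prod_sum_type]
      congr 2
      · rw [← Finset.prod_subset (Finset.subset_univ p) fun y _ hy => ?_]
        · exact Finset.prod_congr rfl fun y hy => by
            rw [Finsupp.tsub_apply, mexp_inl, if_pos hy]
        · have : d (Sum.inl y) = 0 := by simpa [hp] using hy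
          simp [this]
      · rw [← Finset.prod_subset (Finset.subset_univ q) fun z _ hz => ?_]
        · exact Finset.prod_congr rfl fun z hz => by
            rw [Finsupp.tsub_apply, mexp_inr, if_pos hz]
        · have : d (Sum.inr z) = 0 := by simpa [hq] using hz
          simp [this]
    · simp [hq]
  · simp [hp]

theorem evalMatrix_eq_sum_of_subset (S : (Y ⊕ Z) → F) {f : MvPolynomial (Y ⊕ Z) F}
    {D : Finset ((Y ⊕ Z) →₀ ℕ)} (hD : f.support ⊆ D) :
    evalMatrix S f = ∑ d ∈ D, f.coeff d • Matrix.vecMulVec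
      (supportWeight (S ∘ Sum.inl) (d ∘ Sum.inl)) (supportWeight (S ∘ Sum.inr) (d ∘ Sum.inr)) := by
  rw [evalMatrix_eq_sum]
  refine Finset.sum_subset hD fun d _ hd => ?_
  rw [MvPolynomial.notMem_support_iff.mp hd, zero_smul]

theorem evalMatrix_add (S : (Y ⊕ Z) → F) (f g : MvPolynomial (Y ⊕ Z) F) :
    evalMatrix S (f + g) = evalMatrix S f + evalMatrix S g := by
  rw [evalMatrix_eq_sum_of_subset S MvPolynomial.support_add,
    evalMatrix_eq_sum_of_subset S (Finset.subset_union_left (s₂ := g.support)),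
    evalMatrix_eq_sum_of_subset S (Finset.subset_union_right (s₁ := f.support)),
    ← Finset.sum_add_distrib]
  simp only [MvPolynomial.coeff_add, add_smul]

theorem evalMatrix_zero (S : (Y ⊕ Z) → F) :
    evalMatrix S (0 : MvPolynomial (Y ⊕ Z) F) = 0 := by
  simp [evalMatrix_eq_sum]

theorem evalMatrix_monomial (S : (Y ⊕ Z) → F) (d : (Y ⊕ Z) →₀ ℕ) (c : F) :
    evalMatrix S (MvPolynomial.monomial d c) = c • Matrix.vecMulVec
      (supportWeight (S ∘ Sum.inl) (d ∘ Sum.inl)) (supportWeight (S ∘ Sum.inr) (d ∘ Sum.inr)) := by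
  rw [evalMatrix_eq_sum_of_subset S MvPolynomial.support_monomial_subset, Finset.sum_singleton,
    MvPolynomial.coeff_monomial, if_pos rfl]

open Matrix in
theorem evalMatrix_mul_monomial (S : (Y ⊕ Z) → F) (f : MvPolynomial (Y ⊕ Z) F)
    (e : (Y ⊕ Z) →₀ ℕ) (c : F) :
    evalMatrix S (f * MvPolynomial.monomial e c) =
      (c • shiftMatrix (S ∘ Sum.inl) (e ∘ Sum.inl)) * evalMatrix S f *
        (shiftMatrix (S ∘ Sum.inr) (e ∘ Sum.inr))ᵀ := by
  induction f using MvPolynomial.induction_on' with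
  | monomial d a =>
    rw [MvPolynomial.monomial_mul, evalMatrix_monomial, evalMatrix_monomial]
    simp only [Matrix.smul_mul, Matrix.mul_smul, Matrix.mul_vecMulVec, Matrix.vecMulVec_mul,
      Matrix.vecMul_transpose, Matrix.smul_mulVec, Matrix.smul_vecMulVec,
      shiftMatrix_mulVec_supportWeight, smul_smul]
    rfl
  | add f₁ f₂ h₁ h₂ =>
    rw [add_mul, evalMatrix_add, evalMatrix_add, h₁, h₂, Matrix.mul_add, Matrix.add_mul]

theorem rank_evalMatrix_mul_monomial_le (S : (Y ⊕ Z) → F) (f : MvPolynomial (Y ⊕ Z) F)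
    (e : (Y ⊕ Z) →₀ ℕ) (c : F) :
    (evalMatrix S (f * MvPolynomial.monomial e c)).rank ≤ (evalMatrix S f).rank := by
  rw [evalMatrix_mul_monomial]
  exact (Matrix.rank_mul_le_left _ _).trans (Matrix.rank_mul_le_right _ _)

theorem rank_evalMatrix_mul_sum_monomial_le (S : (Y ⊕ Z) → F) (f : MvPolynomial (Y ⊕ Z) F)
    (c : ((Y ⊕ Z) →₀ ℕ) → F) (D : Finset ((Y ⊕ Z) →₀ ℕ)) :
    (evalMatrix S (f * ∑ e ∈ D, MvPolynomial.monomial e (c e))).rank ≤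
      D.card * (evalMatrix S f).rank := by
  induction D using Finset.induction_on with
  | empty => simp [evalMatrix_zero]
  | insert e D he ih =>
    rw [Finset.sum_insert he, mul_add, evalMatrix_add, Finset.card_insert_of_notMem he, add_mul,
      one_mul, add_comm (D.card * _)]
    exact (rank_add_le _ _).trans
      (add_le_add (rank_evalMatrix_mul_monomial_le S f e (c e)) ih)

theorem rank_evalMatrix_le_maxrank (S : (Y ⊕ Z) → F) (f : MvPolynomial (Y ⊕ Z) F) :
    (evalMatrix S f).rank ≤ maxrank f :=
  le_ciSup (f := fun S => (evalMatrix S f).rank)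
    ⟨Fintype.card (Finset Y), by rintro _ ⟨S, rfl⟩; exact Matrix.rank_le_card_height _⟩ S

end PCM

/-- if `g` has at most `r` monomials, then
`maxrank(M_{fg}) ≤ r · maxrank(M_f)`. -/
theorem maxrank_mul_le_of_sparse {F : Type} [Field F] {Y Z : Type} [Fintype Y] [Fintype Z]
    (f g : MvPolynomial (Y ⊕ Z) F) (r : ℕ) (hg : g.support.card ≤ r) :
    PCM.maxrank (f * g) ≤ r * PCM.maxrank f := by
  refine ciSup_le fun S => ?_
  have h := PCM.rank_evalMatrix_mul_sum_monomial_le S f (fun e => g.coeff e) g.support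
  rw [MvPolynomial.support_sum_monomial_coeff] at h
  exact h.trans (Nat.mul_le_mul hg (PCM.rank_evalMatrix_le_maxrank S f))
end
end

section
/- Let l be a homogeneous linear form in F[Y ∪ Z] and let t be a positive integer. Then, for the partition of the variables into Y and Z, maxrank(M_{l^t}) ≤ t + 1. -/
open scoped Classical

noncomputable section

namespace PCM

variable {F σ : Type} [Field F]

/-- The factor contributed by a variable with exponent `n` and value `s` to an evaluated entry of
the coefficient matrix; `b` says whether the variable occurs in the index of the entry. -/
def varWeight (b : Prop) (s : F) (n : ℕ) : F :=
  if b then (if n = 0 then 0 else s ^ (n - 1)) else if n = 0 then 1 else 0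

/-- The linear functional sending a polynomial to the value at `S` of its coefficient (in the sense
of the coefficient matrix) of the multilinear monomial indexed by `p`. -/
def evalCoeff [Fintype σ] (S : σ → F) (p : Finset σ) : MvPolynomial σ F →ₗ[F] F :=
  (MvPolynomial.basisMonomials σ F).constr F fun d => ∏ x, varWeight (x ∈ p) (S x) (d x)

lemma evalCoeff_monomial [Fintype σ] (S : σ → F) (p : Finset σ) (d : σ →₀ ℕ) (c : F) :
    evalCoeff S p (MvPolynomial.monomial d c) = c * ∏ x, varWeight (x ∈ p) (S x) (d x) := by
  have h : MvPolynomial.monomial d c = c • MvPolynomial.basisMonomials σ F d := by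
    simp [MvPolynomial.smul_monomial]
  rw [h, map_smul, evalCoeff, Module.Basis.constr_basis, smul_eq_mul]

variable {Y Z : Type}

lemma mexp_apply (p : Finset Y) (q : Finset Z) (x : Y ⊕ Z) :
    mexp p q x = if x ∈ p.disjSum q then 1 else 0 := by
  cases x <;> simp [mexp, Finsupp.single_apply]

lemma exists_rename_add_rename (l : MvPolynomial (Y ⊕ Z) F) (hl : l.IsHomogeneous 1) :
    ∃ (g : MvPolynomial Y F) (h : MvPolynomial Z F),
      l = MvPolynomial.rename Sum.inl g + MvPolynomial.rename Sum.inr h := by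
  rw [← MvPolynomial.mem_homogeneousSubmodule,
    MvPolynomial.homogeneousSubmodule_one_eq_span_X] at hl
  induction hl using Submodule.span_induction with
  | mem x hx =>
    obtain ⟨y | z, rfl⟩ := hx
    · exact ⟨MvPolynomial.X y, 0, by simp⟩
    · exact ⟨0, MvPolynomial.X z, by simp⟩
  | zero => exact ⟨0, 0, by simp⟩
  | add x y _ _ hx hy =>
    obtain ⟨g₁, h₁, rfl⟩ := hx
    obtain ⟨g₂, h₂, rfl⟩ := hy
    exact ⟨g₁ + g₂, h₁ + h₂, by simp only [map_add]; ring⟩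
  | smul a x _ hx =>
    obtain ⟨g, h, rfl⟩ := hx
    exact ⟨a • g, a • h, by simp only [map_smul, smul_add]⟩

variable [Fintype Y] [Fintype Z]

lemma prod_varWeight (S : Y ⊕ Z → F) (p : Finset Y) (q : Finset Z) (d : (Y ⊕ Z) →₀ ℕ) :
    ∏ x, varWeight (x ∈ p.disjSum q) (S x) (d x) =
      if d.support ⊆ p.image Sum.inl ∪ q.image Sum.inr ∧ mexp p q ≤ d then
        ∏ x, S x ^ (d - mexp p q) x else 0 := by
  have himage : p.image Sum.inl ∪ q.image Sum.inr = p.disjSum q := by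
    ext x; cases x <;> simp
  rw [himage]
  split_ifs with h
  · refine Finset.prod_congr rfl fun x _ => ?_
    have h1 := @h.1 x
    have h2 := h.2 x
    rw [Finsupp.mem_support_iff] at h1
    rw [mexp_apply] at h2
    rw [Finsupp.tsub_apply, mexp_apply, varWeight]
    by_cases hx : x ∈ p.disjSum q
    · simp only [hx, if_true] at h2 ⊢
      rw [if_neg (by omega)]
    · have h0 : d x = 0 := by
        by_contra hne
        exact hx (h1 hne)
      simp [hx, h0]
  · suffices ∃ x, varWeight (x ∈ p.disjSum q) (S x) (d x) = 0 by
      obtain ⟨x, hx⟩ := this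
      exact Finset.prod_eq_zero (Finset.mem_univ x) hx
    rw [not_and_or] at h
    rcases h with h | h
    · obtain ⟨x, hd, hx⟩ := Finset.not_subset.1 h
      rw [Finsupp.mem_support_iff] at hd
      exact ⟨x, by simp [varWeight, hx, hd]⟩
    · rw [Finsupp.le_def] at h
      push Not at h
      obtain ⟨x, hx⟩ := h
      rw [mexp_apply] at hx
      refine ⟨x, ?_⟩
      split_ifs at hx with hm
      · simp [varWeight, hm, Nat.lt_one_iff.1 hx]
      · omega

lemma eval_coeffMatrix (f : MvPolynomial (Y ⊕ Z) F) (S : Y ⊕ Z → F)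
    (p : Finset Y) (q : Finset Z) :
    MvPolynomial.eval S (coeffMatrix f p q) = evalCoeff S (p.disjSum q) f := by
  conv_rhs => rw [f.as_sum, map_sum]
  rw [coeffMatrix, map_sum]
  refine Finset.sum_congr rfl fun d _ => ?_
  rw [evalCoeff_monomial, prod_varWeight]
  split_ifs
  · rw [MvPolynomial.eval_monomial, Finsupp.prod_fintype _ _ fun _ => pow_zero _]
  · simp

lemma evalCoeff_rename_mul_rename (S : Y ⊕ Z → F) (p : Finset Y) (q : Finset Z)
    (g : MvPolynomial Y F) (h : MvPolynomial Z F) :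
    evalCoeff S (p.disjSum q) (MvPolynomial.rename Sum.inl g * MvPolynomial.rename Sum.inr h) =
      evalCoeff (S ∘ Sum.inl) p g * evalCoeff (S ∘ Sum.inr) q h := by
  induction g using MvPolynomial.induction_on' with
  | add g₁ g₂ h₁ h₂ => simp only [map_add, add_mul, h₁, h₂]
  | monomial d a =>
    induction h using MvPolynomial.induction_on' with
    | add g₁ g₂ h₁ h₂ => simp only [map_add, mul_add, h₁, h₂]
    | monomial e b =>
      have hl (y : Y) : (d.mapDomain Sum.inl + e.mapDomain Sum.inr : (Y ⊕ Z) →₀ ℕ) (Sum.inl y) = d y := by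
        rw [Finsupp.add_apply, Finsupp.mapDomain_apply Sum.inl_injective,
          Finsupp.mapDomain_of_notMem_range _ _ (by simp), add_zero]
      have hr (z : Z) : (d.mapDomain Sum.inl + e.mapDomain Sum.inr : (Y ⊕ Z) →₀ ℕ) (Sum.inr z) = e z := by
        rw [Finsupp.add_apply, Finsupp.mapDomain_apply Sum.inr_injective,
          Finsupp.mapDomain_of_notMem_range _ _ (by simp), zero_add]
      rw [MvPolynomial.rename_monomial, MvPolynomial.rename_monomial, MvPolynomial.monomial_mul,
        evalCoeff_monomial, evalCoeff_monomial, evalCoeff_monomial, Fintype.prod_sum_type]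
      simp only [hl, hr, Finset.inl_mem_disjSum, Finset.inr_mem_disjSum, Function.comp_apply]
      ring

end PCM

/-- for a homogeneous linear form `l` and a positive integer `t`,
`maxrank(M_{l^t}) ≤ t + 1`. -/
theorem maxrank_pow_linear_le {F : Type} [Field F] {Y Z : Type} [Fintype Y] [Fintype Z]
    (l : MvPolynomial (Y ⊕ Z) F) (hl : l.IsHomogeneous 1) (t : ℕ) (ht : 0 < t) :
    PCM.maxrank (l ^ t) ≤ t + 1 := by
  obtain ⟨g, h, rfl⟩ := PCM.exists_rename_add_rename l hl
  refine ciSup_le fun S => ?_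
  let A : Matrix (Finset Y) (Fin (t + 1)) F := fun p i =>
    PCM.evalCoeff (S ∘ Sum.inl) p (g ^ (i : ℕ))
  let B : Matrix (Fin (t + 1)) (Finset Z) F := fun i q =>
    PCM.evalCoeff (S ∘ Sum.inr) q (h ^ (t - i)) * (t.choose i : F)
  have hAB : (PCM.coeffMatrix ((MvPolynomial.rename Sum.inl g +
      MvPolynomial.rename Sum.inr h) ^ t)).map (MvPolynomial.eval S) = A * B := by
    ext p q
    rw [Matrix.map_apply, PCM.eval_coeffMatrix, add_pow, map_sum, Matrix.mul_apply,
      Finset.sum_range]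
    refine Finset.sum_congr rfl fun i _ => ?_
    rw [← nsmul_eq_mul', map_nsmul, ← map_pow, ← map_pow, PCM.evalCoeff_rename_mul_rename,
      nsmul_eq_mul', mul_assoc]
  rw [hAB]
  exact (Matrix.rank_mul_le_left A B).trans (by simpa using A.rank_le_card_width)
end
end
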